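/- arXiv:math/9804136 — 2 statements merged into one kernel-verified Lean document; each statement's English description precedes it below -/
import Mathlib

section
/- Let f ∈ C^∞(ℝ^p; ℂ) and suppose that for |ξ| ≥ 1 one has f(ξ) = Σ_{i=1}^N g_i(ξ/|ξ|) |ξ|^{α_i} (log|ξ|)^{l_i} + r(ξ), where N ∈ ℕ, g_i ∈ C^∞(S^{p−1}; ℂ), α_i ∈ ℝ, l_i ∈ ℕ, and r is a smooth function with |r(ξ)| ≤ C (1+|ξ|)^{−p} for all |ξ| ≥ 1. Fix j ∈ {1,…,p} and set c_i := ∫_{S^{p−1}} g_i(ω) ω_j dσ(ω). Then lim_{R→∞} [ ∫_{|ξ|≤R} ∂_j f(ξ) dξ − Σ_{i=1}^N c_i R^{p−1+α_i} (log R)^{l_i} ] = 0. In particular, the constant term in the expansion of ∫_{|ξ|≤R} ∂_j f(ξ) dξ as R → ∞ (the regularized integral ⨍_{ℝ^p} ∂_j f dξ) equals Σ_{i : α_i = 1−p, l_i = 0} ∫_{S^{p−1}} g_i(ω) ω_j dσ(ω). -/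
open MeasureTheory Filter
open scoped Classical Topology

noncomputable section

open Metric Set

section Polar

variable {E F : Type*} [NormedAddCommGroup E] [NormedSpace ℝ E] [FiniteDimensional ℝ E]
  [MeasurableSpace E] [BorelSpace E] [NormedAddCommGroup F] [NormedSpace ℝ F]

/-- Integration in polar coordinates. -/
theorem integral_eq_integral_Ioi_toSphere [Nontrivial E] (μ : Measure E)
    [μ.IsAddHaarMeasure] {u : E → F} (hu : Integrable u μ) :
    ∫ x, u x ∂μ = ∫ ρ in Ioi (0 : ℝ), ρ ^ (Module.finrank ℝ E - 1) •
      ∫ ω : sphere (0 : E) 1, u (ρ • (ω : E)) ∂μ.toSphere := by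
  set n := Module.finrank ℝ E - 1
  have hmp := μ.measurePreserving_homeomorphUnitSphereProd
  have hemb := (homeomorphUnitSphereProd E).measurableEmbedding
  let v : sphere (0 : E) 1 × Ioi (0 : ℝ) → F := fun z => u ((z.2 : ℝ) • (z.1 : E))
  have hv : ∀ x : ({0}ᶜ : Set E), v (homeomorphUnitSphereProd E x) = u x := by
    intro x
    have hx : ‖(x : E)‖ ≠ 0 := norm_ne_zero_iff.2 x.2
    simp [v, smul_smul, hx]
  have hvint : Integrable v (μ.toSphere.prod (Measure.volumeIoiPow n)) := by
    rw [← hmp.integrable_comp_emb hemb]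
    have h := (integrableOn_iff_comap_subtypeVal (measurableSet_singleton (0 : E)).compl).1
      hu.integrableOn
    exact h.congr (Eventually.of_forall fun x => (hv x).symm)
  calc
    ∫ x, u x ∂μ = ∫ x : ({0}ᶜ : Set E), u x ∂(μ.comap (↑)) := by
      rw [integral_subtype_comap (measurableSet_singleton _).compl u, restrict_compl_singleton]
    _ = ∫ x : ({0}ᶜ : Set E), v (homeomorphUnitSphereProd E x) ∂(μ.comap (↑)) := by
      simp only [hv]
    _ = ∫ z, v z ∂(μ.toSphere.prod (Measure.volumeIoiPow n)) := hmp.integral_comp hemb v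
    _ = ∫ ρ, ∫ ω, v (ω, ρ) ∂μ.toSphere ∂(Measure.volumeIoiPow n) := integral_prod_symm v hvint
    _ = _ := by
      rw [Measure.volumeIoiPow]
      simp only [ENNReal.ofReal]
      rw [integral_withDensity_eq_integral_smul (by fun_prop),
        ← integral_subtype_comap measurableSet_Ioi]
      refine integral_congr_ae (Eventually.of_forall fun ρ => ?_)
      simp [v, NNReal.smul_def, pow_nonneg (mem_Ioi.1 ρ.2).le]

theorem continuous_integral_toSphere (μ : Measure E) [μ.IsAddHaarMeasure] 
    {u : ℝ → sphere (0 : E) 1 → F} (hu : Continuous u.uncurry) :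
    Continuous fun ρ : ℝ => ∫ ω, u ρ ω ∂μ.toSphere := by
  simpa using continuous_parametric_integral_of_continuous (μ := μ.toSphere) hu isCompact_univ

/-- Integration of a continuous function over a ball in polar coordinates. -/
theorem setIntegral_closedBall_eq_intervalIntegral_toSphere [Nontrivial E] (μ : Measure E)
    [μ.IsAddHaarMeasure] {u : E → F} (hu : Continuous u) {R : ℝ} (hR : 0 ≤ R) :
    ∫ x in closedBall (0 : E) R, u x ∂μ = ∫ ρ in (0 : ℝ)..R, ρ ^ (Module.finrank ℝ E - 1) •
      ∫ ω : sphere (0 : E) 1, u (ρ • (ω : E)) ∂μ.toSphere := by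
  have hint_ball : IntegrableOn u (closedBall 0 R) μ :=
    hu.continuousOn.integrableOn_compact (isCompact_closedBall _ _)
  rw [← integral_indicator measurableSet_closedBall,
    integral_eq_integral_Ioi_toSphere μ (hint_ball.integrable_indicator measurableSet_closedBall),
    intervalIntegral.integral_of_le hR, ← integral_indicator measurableSet_Ioi,
    ← integral_indicator measurableSet_Ioc]
  congr 1
  ext ρ
  by_cases hρ : 0 < ρ
  · by_cases hρR : ρ ≤ R
    · simp [indicator, hρ, hρR, norm_smul, abs_of_pos hρ]
    · simp [indicator, hρ, hρR, norm_smul, abs_of_pos hρ]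
  · simp [hρ]

end Polar

section Weighted

variable {F : Type*} [NormedAddCommGroup F] [NormedSpace ℝ F]

theorem hasDerivAt_max_zero_sq (t : ℝ) :
    HasDerivAt (fun s : ℝ => max s 0 ^ 2) (2 * max t 0) t := by
  rcases lt_trichotomy t 0 with ht | rfl | ht
  · rw [max_eq_right ht.le, mul_zero]
    refine (hasDerivAt_const t (0 : ℝ)).congr_of_eventuallyEq ?_
    filter_upwards [Iio_mem_nhds ht] with s hs
    simp [max_eq_right (mem_Iio.1 hs).le]
  · rw [max_self, mul_zero]
    refine HasDerivAt.of_isLittleO (Asymptotics.IsBigO.trans_isLittleO (g := fun s : ℝ => s ^ 2)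
      (Asymptotics.IsBigO.of_bound 1 (Eventually.of_forall fun s => ?_)) ?_)
    · rcases le_total s 0 with h | h <;> simp [h, sq_nonneg]
    · simpa using Asymptotics.isLittleO_pow_id (𝕜 := ℝ) one_lt_two
  · rw [max_eq_left ht.le]
    refine HasDerivAt.congr_of_eventuallyEq (f := fun s : ℝ => s ^ 2)
      (by simpa using hasDerivAt_pow 2 t) ?_
    filter_upwards [Ioi_mem_nhds ht] with s hs
    simp [max_eq_left (mem_Ioi.1 hs).le]

variable {E : Type*} [NormedAddCommGroup E] [InnerProductSpace ℝ E] [FiniteDimensional ℝ E]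
  [MeasurableSpace E] [BorelSpace E]

/-- Integration by parts against the weight `(R² - ‖x‖²)²`, which vanishes on the boundary
of the ball. -/
theorem setIntegral_closedBall_weight_smul_fderiv (μ : Measure E) [μ.IsAddHaarMeasure]
    {f : E → F} (hf : ContDiff ℝ 1 f) (v : E) {R : ℝ} (hR : 0 ≤ R) :
    ∫ x in closedBall (0 : E) R, (R ^ 2 - ‖x‖ ^ 2) ^ 2 • fderiv ℝ f x v ∂μ =
      ∫ x in closedBall (0 : E) R, (4 * (R ^ 2 - ‖x‖ ^ 2) * inner ℝ x v) • f x ∂μ := by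
  let φ : E → ℝ := fun x => max (R ^ 2 - ‖x‖ ^ 2) 0 ^ 2
  have hφ_deriv : ∀ x, HasFDerivAt φ
      ((2 * max (R ^ 2 - ‖x‖ ^ 2) 0) • (-(2 • innerSL ℝ x) : E →L[ℝ] ℝ)) x := fun x =>
    (hasDerivAt_max_zero_sq _).comp_hasFDerivAt x
      ((hasStrictFDerivAt_norm_sq x).hasFDerivAt.const_sub (R ^ 2))
  have hφ'v : ∀ x, fderiv ℝ φ x v = -(4 * max (R ^ 2 - ‖x‖ ^ 2) 0 * inner ℝ x v) := by
    intro x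
    rw [(hφ_deriv x).fderiv]
    simp
    ring
  have hmem : ∀ x ∈ closedBall (0 : E) R, max (R ^ 2 - ‖x‖ ^ 2) 0 = R ^ 2 - ‖x‖ ^ 2 := by
    intro x hx
    rw [mem_closedBall_zero_iff] at hx
    exact max_eq_left (sub_nonneg.2 (pow_le_pow_left₀ (norm_nonneg x) hx 2))
  have hnot : ∀ x ∉ closedBall (0 : E) R, max (R ^ 2 - ‖x‖ ^ 2) 0 = 0 := by
    intro x hx
    rw [mem_closedBall_zero_iff, not_le] at hx
    exact max_eq_right (sub_nonpos.2 (pow_le_pow_left₀ hR hx.le 2))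
  have hfv : Continuous fun x => fderiv ℝ f x v :=
    (hf.continuous_fderiv one_ne_zero).clm_apply continuous_const
  have hfc := hf.continuous
  have hint_ball : ∀ {w : E → F}, Continuous w → (∀ x ∉ closedBall (0 : E) R, w x = 0) →
      Integrable w μ := fun hw h0 =>
    hw.integrable_of_hasCompactSupport (HasCompactSupport.intro (isCompact_closedBall 0 R) h0)
  have hparts := integral_smul_fderiv_eq_neg_fderiv_smul_of_integrable (μ := μ) (f := φ) (g := f)
    (v := v)
    (by
      simp only [hφ'v]
      refine hint_ball (by fun_prop) fun x hx => ?_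
      simp [hnot x hx])
    (hint_ball (by fun_prop) fun x hx => by simp [φ, hnot x hx])
    (hint_ball (by fun_prop) fun x hx => by simp [φ, hnot x hx])
    (fun x _ => (hφ_deriv x).differentiableAt)
    (fun x _ => hf.differentiable one_ne_zero x)
  rw [← integral_neg] at hparts
  calc
    _ = ∫ x in closedBall (0 : E) R, φ x • fderiv ℝ f x v ∂μ :=
      setIntegral_congr_fun measurableSet_closedBall fun x hx => by simp [φ, hmem x hx]
    _ = ∫ x, φ x • fderiv ℝ f x v ∂μ :=
      setIntegral_eq_integral_of_forall_compl_eq_zero fun x hx => by simp [φ, hnot x hx]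
    _ = ∫ x, -(fderiv ℝ φ x v • f x) ∂μ := hparts
    _ = ∫ x in closedBall (0 : E) R, -(fderiv ℝ φ x v • f x) ∂μ :=
      (setIntegral_eq_integral_of_forall_compl_eq_zero fun x hx => by
        simp [hφ'v, hnot x hx]).symm
    _ = _ := setIntegral_congr_fun measurableSet_closedBall fun x hx => by
        simp [hφ'v, hmem x hx]

end Weighted

section Calculus

variable {F : Type*} [NormedAddCommGroup F] [NormedSpace ℝ F]

theorem integral_sq_sub_sq_smul {u : ℝ → F} (hu : Continuous u) (R : ℝ) :
    ∫ ρ in (0 : ℝ)..R, (R ^ 2 - ρ ^ 2) • u ρ =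
      R ^ 2 • (∫ ρ in (0 : ℝ)..R, u ρ) - ∫ ρ in (0 : ℝ)..R, ρ ^ 2 • u ρ := by
  simp only [sub_smul]
  rw [intervalIntegral.integral_sub (Continuous.intervalIntegrable (by fun_prop) _ _)
    (Continuous.intervalIntegrable (by fun_prop) _ _), intervalIntegral.integral_smul]

variable [CompleteSpace F]

theorem hasDerivAt_integral_sq_sub_sq_smul {u : ℝ → F} (hu : Continuous u) (R : ℝ) :
    HasDerivAt (fun R => ∫ ρ in (0 : ℝ)..R, (R ^ 2 - ρ ^ 2) • u ρ)
      ((2 * R) • ∫ ρ in (0 : ℝ)..R, u ρ) R := by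
  have hu2 : Continuous fun ρ : ℝ => ρ ^ 2 • u ρ := by fun_prop
  simp only [integral_sq_sub_sq_smul hu]
  refine (((hasDerivAt_pow 2 R).smul (hu.integral_hasStrictDerivAt 0 R).hasDerivAt).sub
    (hu2.integral_hasStrictDerivAt 0 R).hasDerivAt).congr_deriv ?_
  norm_num

theorem hasDerivAt_integral_sq_sub_sq_sq_smul {u : ℝ → F} (hu : Continuous u) (R : ℝ) :
    HasDerivAt (fun R => ∫ ρ in (0 : ℝ)..R, (R ^ 2 - ρ ^ 2) ^ 2 • u ρ)
      ((4 * R) • ∫ ρ in (0 : ℝ)..R, (R ^ 2 - ρ ^ 2) • u ρ) R := by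
  have hu2 : Continuous fun ρ : ℝ => ρ ^ 2 • u ρ := by fun_prop
  have h : (fun R => ∫ ρ in (0 : ℝ)..R, (R ^ 2 - ρ ^ 2) ^ 2 • u ρ) =
      fun R => R ^ 2 • (∫ ρ in (0 : ℝ)..R, (R ^ 2 - ρ ^ 2) • u ρ) -
        ∫ ρ in (0 : ℝ)..R, (R ^ 2 - ρ ^ 2) • ρ ^ 2 • u ρ := by
    ext R
    rw [← intervalIntegral.integral_smul, ← intervalIntegral.integral_sub
      (Continuous.intervalIntegrable (by fun_prop) _ _)
      (Continuous.intervalIntegrable (by fun_prop) _ _)]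
    congr 1
    ext ρ
    module
  rw [h]
  refine (((hasDerivAt_pow 2 R).smul (hasDerivAt_integral_sq_sub_sq_smul hu R)).sub
    (hasDerivAt_integral_sq_sub_sq_smul hu2 R)).congr_deriv ?_
  rw [integral_sq_sub_sq_smul hu]
  norm_num
  module

/-- Two differentiations in `R` remove the weight `(R² - ρ²)²`. -/
theorem integral_eq_of_integral_weight_eq {a b : ℝ → F} (ha : Continuous a) (hb : Continuous b)
    (h : ∀ R : ℝ, 0 < R → ∫ ρ in (0 : ℝ)..R, (R ^ 2 - ρ ^ 2) ^ 2 • a ρ =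
      ∫ ρ in (0 : ℝ)..R, (R ^ 2 - ρ ^ 2) • (4 * ρ) • b ρ) {R : ℝ} (hR : 0 < R) :
    ∫ ρ in (0 : ℝ)..R, a ρ = b R := by
  have hb' : Continuous fun ρ : ℝ => (4 * ρ) • b ρ := by fun_prop
  have hfirst : ∀ R : ℝ, 0 < R → ∫ ρ in (0 : ℝ)..R, (R ^ 2 - ρ ^ 2) • a ρ =
      (2 : ℝ)⁻¹ • ∫ ρ in (0 : ℝ)..R, (4 * ρ) • b ρ := by
    intro R hR
    have hd := (hasDerivAt_integral_sq_sub_sq_sq_smul ha R).unique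
      ((hasDerivAt_integral_sq_sub_sq_smul hb' R).congr_of_eventuallyEq
        (by filter_upwards [Ioi_mem_nhds hR] with S hS using h S hS))
    have h4 : (4 * R) ≠ 0 := by positivity
    apply smul_right_injective F h4
    dsimp only
    rw [hd, smul_smul]
    congr 1
    ring
  have hd := (hasDerivAt_integral_sq_sub_sq_smul ha R).unique
    (((hb'.integral_hasStrictDerivAt 0 R).hasDerivAt.const_smul (2 : ℝ)⁻¹).congr_of_eventuallyEq
      (by filter_upwards [Ioi_mem_nhds hR] with S hS using hfirst S hS))
  have h2 : (2 * R) ≠ 0 := by positivity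
  apply smul_right_injective F h2
  dsimp only
  rw [hd, smul_smul]
  congr 1
  ring

end Calculus

/-- The divergence theorem on a ball, for the vector field `f • v` with `v` constant. -/
theorem setIntegral_closedBall_fderiv {E F : Type*} [NormedAddCommGroup E]
    [InnerProductSpace ℝ E] [FiniteDimensional ℝ E] [Nontrivial E] [MeasurableSpace E]
    [BorelSpace E] [NormedAddCommGroup F] [NormedSpace ℝ F] [CompleteSpace F]
    (μ : Measure E) [μ.IsAddHaarMeasure] {f : E → F} (hf : ContDiff ℝ 1 f) (v : E)
    {R : ℝ} (hR : 0 < R) :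
    ∫ x in closedBall (0 : E) R, fderiv ℝ f x v ∂μ = R ^ (Module.finrank ℝ E - 1) •
      ∫ ω : sphere (0 : E) 1, inner ℝ (ω : E) v • f (R • (ω : E)) ∂μ.toSphere := by
  have hfc := hf.continuous
  have hfv : Continuous fun x => fderiv ℝ f x v :=
    (hf.continuous_fderiv one_ne_zero).clm_apply continuous_const
  have hA : Continuous fun ρ : ℝ =>
      ∫ ω : sphere (0 : E) 1, fderiv ℝ f (ρ • (ω : E)) v ∂μ.toSphere :=
    continuous_integral_toSphere μ (by unfold Function.uncurry; fun_prop)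
  have hG : Continuous fun ρ : ℝ =>
      ∫ ω : sphere (0 : E) 1, inner ℝ (ω : E) v • f (ρ • (ω : E)) ∂μ.toSphere :=
    continuous_integral_toSphere μ (by unfold Function.uncurry; fun_prop)
  rw [setIntegral_closedBall_eq_intervalIntegral_toSphere μ hfv hR.le]
  refine integral_eq_of_integral_weight_eq
    (b := fun ρ => ρ ^ (Module.finrank ℝ E - 1) •
      ∫ ω : sphere (0 : E) 1, inner ℝ (ω : E) v • f (ρ • (ω : E)) ∂μ.toSphere)
    (by fun_prop) (by fun_prop) (fun S hS => ?_) hR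
  have hw := setIntegral_closedBall_weight_smul_fderiv μ hf v hS.le
  rw [setIntegral_closedBall_eq_intervalIntegral_toSphere μ (by fun_prop) hS.le,
    setIntegral_closedBall_eq_intervalIntegral_toSphere μ (by fun_prop) hS.le] at hw
  convert hw using 3 with ρ ρ
  · simp only [norm_smul, norm_eq_of_mem_sphere, mul_one, Real.norm_eq_abs, sq_abs,
      integral_smul]
    rw [smul_comm]
  · simp only [norm_smul, norm_eq_of_mem_sphere, mul_one, Real.norm_eq_abs, sq_abs,
      real_inner_smul_left, ← integral_smul]
    congr 1
    ext ω
    simp only [smul_smul]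
    congr 1
    ring

/-- let `f ∈ C^∞(ℝ^p;ℂ)` with `f(ξ) = Σᵢ gᵢ(ξ/|ξ|)|ξ|^{αᵢ} log^{lᵢ}|ξ| + r(ξ)`
for `|ξ| ≥ 1`, where `|r(ξ)| ≤ C(1+|ξ|)^{-p}`.  Fix `j` and set
`cᵢ = ∫_{S^{p-1}} gᵢ(ω) ωⱼ dσ(ω)`.  Then
`∫_{|ξ|≤R} ∂ⱼf dξ - Σᵢ cᵢ R^{p-1+αᵢ} (log R)^{lᵢ} → 0` as `R → ∞`; in
particular the constant term of the expansion of `∫_{|ξ|≤R} ∂ⱼf dξ` (the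
regularized integral of `∂ⱼf`) equals `Σ_{i : αᵢ = 1-p, lᵢ = 0} cᵢ`. -/
theorem stmt_7 (p : ℕ) (hp : 1 ≤ p)
    (f : EuclideanSpace ℝ (Fin p) → ℂ) (hf : ContDiff ℝ (⊤ : ℕ∞) f)
    (N : ℕ) (g : Fin N → EuclideanSpace ℝ (Fin p) → ℂ)
    (hg : ∀ i, ContDiffOn ℝ (⊤ : ℕ∞) (g i) (Metric.sphere 0 1))
    (α : Fin N → ℝ) (l : Fin N → ℕ)
    (r : EuclideanSpace ℝ (Fin p) → ℂ)
    (hr_smooth : ContDiffOn ℝ (⊤ : ℕ∞) r {ξ | 1 ≤ ‖ξ‖})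
    (C : ℝ) (hr_bound : ∀ ξ : EuclideanSpace ℝ (Fin p), 1 ≤ ‖ξ‖ →
      ‖r ξ‖ ≤ C * (1 + ‖ξ‖) ^ (-(p : ℝ)))
    (hexp : ∀ ξ : EuclideanSpace ℝ (Fin p), 1 ≤ ‖ξ‖ →
      f ξ = ∑ i, g i (‖ξ‖⁻¹ • ξ) * ((‖ξ‖ ^ α i : ℝ) : ℂ)
          * ((Real.log ‖ξ‖ ^ l i : ℝ) : ℂ) + r ξ)
    (j : Fin p) (c : Fin N → ℂ)
    (hc : c = fun i => ∫ ω : Metric.sphere (0 : EuclideanSpace ℝ (Fin p)) 1,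
      g i ω * (((ω : EuclideanSpace ℝ (Fin p)) j : ℝ) : ℂ)
        ∂((volume : Measure (EuclideanSpace ℝ (Fin p))).toSphere)) :
    Tendsto (fun R : ℝ =>
        (∫ ξ in Metric.closedBall (0 : EuclideanSpace ℝ (Fin p)) R,
          fderiv ℝ f ξ (EuclideanSpace.single j 1))
        - ∑ i, c i * ((R ^ ((p : ℝ) - 1 + α i) : ℝ) : ℂ)
            * ((Real.log R ^ l i : ℝ) : ℂ))
      atTop (𝓝 0) ∧
    Tendsto (fun R : ℝ =>
        (∫ ξ in Metric.closedBall (0 : EuclideanSpace ℝ (Fin p)) R,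
          fderiv ℝ f ξ (EuclideanSpace.single j 1))
        - ∑ i ∈ Finset.univ.filter (fun i => ¬(α i = 1 - p ∧ l i = 0)),
            c i * ((R ^ ((p : ℝ) - 1 + α i) : ℝ) : ℂ)
              * ((Real.log R ^ l i : ℝ) : ℂ))
      atTop (𝓝 (∑ i ∈ Finset.univ.filter (fun i => α i = 1 - p ∧ l i = 0),
        c i)) := by
  have : Nonempty (Fin p) := ⟨j⟩
  have hfin : Module.finrank ℝ (EuclideanSpace ℝ (Fin p)) - 1 = p - 1 := by simp
  set σ := (volume : Measure (EuclideanSpace ℝ (Fin p))).toSphere with hσ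
  have hmain : Tendsto (fun R : ℝ =>
        (∫ ξ in Metric.closedBall (0 : EuclideanSpace ℝ (Fin p)) R,
          fderiv ℝ f ξ (EuclideanSpace.single j 1))
        - ∑ i, c i * ((R ^ ((p : ℝ) - 1 + α i) : ℝ) : ℂ)
            * ((Real.log R ^ l i : ℝ) : ℂ))
      atTop (𝓝 0) := by
    have hlim : Tendsto (fun R : ℝ => |C| * σ.real univ * R⁻¹) atTop (𝓝 0) := by
      simpa using tendsto_inv_atTop_zero.const_mul (|C| * σ.real univ)
    refine squeeze_zero_norm' ?_ hlim
    filter_upwards [eventually_ge_atTop 1] with R hR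
    have hR0 : 0 < R := one_pos.trans_le hR
    have hnorm : ∀ ω : sphere (0 : EuclideanSpace ℝ (Fin p)) 1,
        ‖R • (ω : EuclideanSpace ℝ (Fin p))‖ = R := by
      intro ω
      simp [norm_smul, abs_of_pos hR0]
    have hgint : ∀ i, Integrable (fun ω : sphere (0 : EuclideanSpace ℝ (Fin p)) 1 =>
        g i ω * (((ω : EuclideanSpace ℝ (Fin p)) j : ℝ) : ℂ)) σ := by
      intro i
      have hgc := (hg i).continuousOn.domRestrict
      refine Continuous.integrable_of_hasCompactSupport ?_ (HasCompactSupport.of_compactSpace _)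
      exact hgc.mul (by fun_prop)
    have hfint : Integrable (fun ω : sphere (0 : EuclideanSpace ℝ (Fin p)) 1 =>
        (ω : EuclideanSpace ℝ (Fin p)) j • f (R • (ω : EuclideanSpace ℝ (Fin p)))) σ := by
      have hfc := hf.continuous
      exact Continuous.integrable_of_hasCompactSupport (by fun_prop)
        (HasCompactSupport.of_compactSpace _)
    have hpow : ∀ i, (R ^ ((p : ℝ) - 1 + α i) : ℝ) = R ^ (p - 1) * R ^ α i := by
      intro i
      rw [Real.rpow_add hR0, ← Real.rpow_natCast, Nat.cast_sub hp, Nat.cast_one]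
    have hdiff : (∫ ξ in Metric.closedBall (0 : EuclideanSpace ℝ (Fin p)) R,
          fderiv ℝ f ξ (EuclideanSpace.single j 1))
        - ∑ i, c i * ((R ^ ((p : ℝ) - 1 + α i) : ℝ) : ℂ) * ((Real.log R ^ l i : ℝ) : ℂ)
        = R ^ (p - 1) • ∫ ω : sphere (0 : EuclideanSpace ℝ (Fin p)) 1,
          (ω : EuclideanSpace ℝ (Fin p)) j • r (R • (ω : EuclideanSpace ℝ (Fin p))) ∂σ := by
      have hr_eq : ∀ ω : sphere (0 : EuclideanSpace ℝ (Fin p)) 1,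
          (ω : EuclideanSpace ℝ (Fin p)) j • r (R • (ω : EuclideanSpace ℝ (Fin p))) =
          (ω : EuclideanSpace ℝ (Fin p)) j • f (R • (ω : EuclideanSpace ℝ (Fin p))) -
          ∑ i, g i ω * (((ω : EuclideanSpace ℝ (Fin p)) j : ℝ) : ℂ) *
            (((R ^ α i : ℝ) : ℂ) * ((Real.log R ^ l i : ℝ) : ℂ)) := by
        intro ω
        rw [hexp _ (by rw [hnorm]; exact hR), hnorm, inv_smul_smul₀ hR0.ne', smul_add,
          Finset.smul_sum, add_comm, eq_sub_iff_add_eq, add_right_inj]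
        refine Finset.sum_congr rfl fun i _ => ?_
        rw [Complex.real_smul]
        ring
      simp only [hr_eq]
      rw [integral_sub hfint (integrable_finsetSum _ fun i _ => (hgint i).mul_const _),
        integral_finsetSum _ (fun i _ => (hgint i).mul_const _),
        setIntegral_closedBall_fderiv volume (hf.of_le (by exact_mod_cast le_top)) _ hR0, hfin,
        smul_sub, Finset.smul_sum]
      congr 1
      · simp [EuclideanSpace.inner_single_right, hσ]
      · refine Finset.sum_congr rfl fun i _ => ?_
        rw [integral_mul_const, hpow, hc, Complex.real_smul]
        push_cast
        ring
    rw [hdiff, norm_smul, Real.norm_of_nonneg (by positivity)]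
    have hbound : ∀ ω : sphere (0 : EuclideanSpace ℝ (Fin p)) 1,
        ‖(ω : EuclideanSpace ℝ (Fin p)) j • r (R • (ω : EuclideanSpace ℝ (Fin p)))‖ ≤
          |C| * (R ^ p)⁻¹ := by
      intro ω
      have hω : ‖(ω : EuclideanSpace ℝ (Fin p)) j‖ ≤ 1 :=
        (PiLp.norm_apply_le _ j).trans (norm_eq_of_mem_sphere ω).le
      have hrω := hr_bound (R • (ω : EuclideanSpace ℝ (Fin p))) (by rw [hnorm]; exact hR)
      rw [hnorm, Real.rpow_neg (by positivity), Real.rpow_natCast] at hrω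
      rw [norm_smul]
      calc _ ≤ 1 * (C * ((1 + R) ^ p)⁻¹) := by gcongr
        _ ≤ |C| * ((1 + R) ^ p)⁻¹ := by
          rw [one_mul]
          gcongr
          exact le_abs_self C
        _ ≤ |C| * (R ^ p)⁻¹ := by
          gcongr
          linarith
    calc _ ≤ R ^ (p - 1) * (|C| * (R ^ p)⁻¹ * σ.real univ) := by
          gcongr
          exact norm_integral_le_of_norm_le_const (Eventually.of_forall hbound)
      _ = |C| * σ.real univ * R⁻¹ := by
          obtain ⟨q, rfl⟩ := Nat.exists_eq_add_of_le' hp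
          simp only [Nat.add_sub_cancel]
          field_simp
          ring
  refine ⟨hmain, ?_⟩
  have hadd := hmain.add_const (∑ i ∈ Finset.univ.filter (fun i => α i = 1 - p ∧ l i = 0), c i)
  rw [zero_add] at hadd
  refine hadd.congr' ?_
  filter_upwards [eventually_gt_atTop 0] with R hR
  rw [← Finset.sum_filter_add_sum_filter_not Finset.univ (fun i => α i = 1 - p ∧ l i = 0)
    (fun i => c i * ((R ^ ((p : ℝ) - 1 + α i) : ℝ) : ℂ) * ((Real.log R ^ l i : ℝ) : ℂ))]
  have hconst : ∑ i ∈ Finset.univ.filter (fun i => α i = 1 - p ∧ l i = 0),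
      c i * ((R ^ ((p : ℝ) - 1 + α i) : ℝ) : ℂ) * ((Real.log R ^ l i : ℝ) : ℂ) =
      ∑ i ∈ Finset.univ.filter (fun i => α i = 1 - p ∧ l i = 0), c i := by
    refine Finset.sum_congr rfl fun i hi => ?_
    obtain ⟨hα, hl⟩ := (Finset.mem_filter.1 hi).2
    simp [hα, hl]
  rw [hconst]
  ring
end
end

section
/- For x_0 ∈ ℝ and x' = (x'_1,…,x'_p) ∈ ℝ^p, set M := x_0·I − Σ_{i=1}^p x'_i E_i. Then Σ_{σ ∈ S_p} sgn(σ) · tr( M E_{σ(1)} M E_{σ(2)} ⋯ M E_{σ(p)} ) = p! · x_0 · (x_0² + |x'|²)^{(p−1)/2} · tr(E_1 E_2 ⋯ E_p). -/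
open Matrix

section CliffordLists

variable {ι A : Type*} [Ring A] {F : ι → A}

theorem mul_list_prod_of_anticommute (hF : ∀ i j, i ≠ j → F i * F j = -(F j * F i))
    {i : ι} {l : List ι} (hi : i ∉ l) :
    F i * (l.map F).prod = (-1) ^ l.length * ((l.map F).prod * F i) := by
  induction l with
  | nil => simp
  | cons a t ih =>
    simp only [List.mem_cons, not_or] at hi
    rw [List.map_cons, List.prod_cons, ← mul_assoc, hF i a hi.1, neg_mul, mul_assoc, ih hi.2,
      List.length_cons, pow_succ]
    rcases neg_one_pow_eq_or A t.length with h | h <;> simp [h, mul_assoc]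

/-- A product of an odd number of distinct anticommuting elements commutes with each of them. -/
theorem commute_list_prod_of_anticommute (hF : ∀ i j, i ≠ j → F i * F j = -(F j * F i))
    {i : ι} {l : List ι} (hl : l.Nodup) (hi : i ∈ l) (hodd : Odd l.length) :
    F i * (l.map F).prod = (l.map F).prod * F i := by
  obtain ⟨s, t, rfl⟩ := List.append_of_mem hi
  have hs : i ∉ s := fun h => by
    simpa using (List.nodup_append.1 hl).2.2 i h i
  have ht : i ∉ t := (List.nodup_cons.1 (List.nodup_append.1 hl).2.1).1
  have e1 := mul_list_prod_of_anticommute hF hs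
  have e2 := mul_list_prod_of_anticommute hF ht
  simp only [List.map_append, List.map_cons, List.prod_append, List.prod_cons]
  simp only [List.length_append, List.length_cons] at hodd
  have h : Even (s.length + t.length) := by
    rw [← add_assoc] at hodd
    exact Nat.not_odd_iff_even.1 (Nat.odd_add_one.1 hodd)
  rw [← mul_assoc, e1]
  rcases Nat.even_or_odd s.length with h1 | h1
  · have h2 : Even t.length := by simpa [Nat.even_add, h1] using h
    rw [h2.neg_one_pow, one_mul] at e2
    rw [h1.neg_one_pow, one_mul, mul_assoc, mul_assoc, mul_assoc, e2]
  · have h2 : Odd t.length := by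
      rw [← Nat.not_even_iff_odd] at h1 ⊢
      simpa [Nat.even_add, h1] using h
    rw [h2.neg_one_pow, neg_one_mul] at e2
    rw [h1.neg_one_pow, neg_one_mul, mul_assoc _ _ (F i), mul_assoc (F i) _ (F i),
      ← neg_eq_iff_eq_neg.2 e2]
    simp [mul_assoc]

variable [Algebra ℝ A]

theorem list_prod_mul_eq_smul_of_even {m m' : A} {R : ℝ} (hmm : m * m' = R • (1 : A))
    {n : ℕ} {l : List ι} (hm : ∀ i ∈ l, F i * m = m' * F i) (hl : l.length = 2 * n) :
    (l.map fun i => m * F i).prod = R ^ n • (l.map F).prod := by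
  induction n generalizing l with
  | zero => simp [List.length_eq_zero_iff.1 hl]
  | succ n ih =>
    match l, hl, hm with
    | a :: b :: t, hl, hm =>
      have ht := ih (l := t) (fun i hi => hm i (by simp [hi])) (by simp at hl; omega)
      have ha : m * F a * m = R • F a := by
        rw [mul_assoc, hm a (by simp), ← mul_assoc, hmm, smul_one_mul]
      simp only [List.map_cons, List.prod_cons, ht]
      rw [← mul_assoc, ← mul_assoc (m * F a), ha, pow_succ]
      simp [mul_assoc, smul_smul]

theorem list_prod_mul_eq_smul_of_odd {m m' : A} {R : ℝ} (hmm : m * m' = R • (1 : A))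
    {n : ℕ} {l : List ι} (hm : ∀ i ∈ l, F i * m = m' * F i) (hl : l.length = 2 * n + 1) :
    (l.map fun i => m * F i).prod = R ^ n • (m * (l.map F).prod) := by
  match l, hl, hm with
  | a :: t, hl, hm =>
    have ht := list_prod_mul_eq_smul_of_even hmm (l := t) (n := n)
      (fun i hi => hm i (by simp [hi])) (by simpa using hl)
    simp [ht, mul_assoc]

/-- For `m = x₀ - r e` with `e = F i₀`, the product of the `m * F i` over an odd-length list of
distinct indices containing `i₀` is, up to the sign of `r`, a power of `x₀² + r²` times
`m` times the product of the `F i`. -/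
theorem exists_list_prod_mul_eq (hF : ∀ i j, i ≠ j → F i * F j = -(F j * F i))
    (hsq : ∀ i, F i * F i = -1) {i₀ : ι} (x₀ r : ℝ) {n : ℕ} {l : List ι} (hl : l.Nodup)
    (hi : i₀ ∈ l) (hlen : l.length = 2 * n + 1) :
    ∃ s : ℝ, (l.map fun i => (x₀ • (1 : A) - r • F i₀) * F i).prod
      = (x₀ ^ 2 + r ^ 2) ^ n • ((x₀ • (1 : A) - s • F i₀) * (l.map F).prod) := by
  obtain ⟨u, v, rfl⟩ := List.append_of_mem hi
  have hu : i₀ ∉ u := fun h => by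
    simpa using (List.nodup_append.1 hl).2.2 i₀ h i₀
  have hv : i₀ ∉ v := (List.nodup_cons.1 (List.nodup_append.1 hl).2.1).1
  set m : A := x₀ • (1 : A) - r • F i₀ with hmdef
  set m' : A := x₀ • (1 : A) + r • F i₀ with hm'def
  have hmm : m * m' = (x₀ ^ 2 + r ^ 2) • (1 : A) := by
    simp only [hmdef, hm'def, sub_mul, mul_add, smul_mul_assoc, mul_smul_comm, one_mul, mul_one,
      hsq]
    module
  have hmF : ∀ i, i ≠ i₀ → F i * m = m' * F i := fun i hi => by
    simp only [hmdef, hm'def, mul_sub, add_mul, smul_mul_assoc, mul_smul_comm, one_mul, mul_one,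
      hF i i₀ hi]
    module
  have hme : F i₀ * m = m * F i₀ := by
    simp only [hmdef, mul_sub, sub_mul, smul_mul_assoc, mul_smul_comm, one_mul, mul_one]
  have hmu : ∀ i ∈ u, F i * m = m' * F i := fun i h => hmF i (by rintro rfl; exact hu h)
  have hmv : ∀ i ∈ v, F i * m = m' * F i := fun i h => hmF i (by rintro rfl; exact hv h)
  have eu := mul_list_prod_of_anticommute hF hu
  simp only [List.length_append, List.length_cons] at hlen
  simp only [List.map_append, List.map_cons, List.prod_append, List.prod_cons]
  rcases Nat.even_or_odd' u.length with ⟨a, ha | ha⟩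
  · obtain ⟨b, rfl⟩ : ∃ b, n = a + b := ⟨n - a, by omega⟩
    refine ⟨r, ?_⟩
    rw [ha, (even_two_mul a).neg_one_pow, one_mul] at eu
    have hqm : (u.map F).prod * m = m * (u.map F).prod := by
      simp only [hmdef, mul_sub, sub_mul, smul_mul_assoc, mul_smul_comm, one_mul, mul_one, eu]
    rw [list_prod_mul_eq_smul_of_even hmm hmu ha,
      list_prod_mul_eq_smul_of_even hmm hmv (n := b) (by omega), ← hmdef, ← mul_assoc m, ← hqm]
    simp only [smul_mul_assoc, mul_smul_comm, smul_smul, pow_add, mul_assoc]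
    rw [mul_comm]
  · obtain ⟨b, rfl⟩ : ∃ b, n = a + b + 1 := ⟨n - a - 1, by omega⟩
    refine ⟨-r, ?_⟩
    rw [ha, (odd_two_mul_add_one a).neg_one_pow, neg_one_mul] at eu
    have hqm : (u.map F).prod * m = m' * (u.map F).prod := by
      simp only [hmdef, hm'def, mul_sub, add_mul, smul_mul_assoc, mul_smul_comm, one_mul, mul_one,
        eu]
      module
    have hm'eq : x₀ • (1 : A) - (-r) • F i₀ = m' := by rw [hm'def]; module
    rw [list_prod_mul_eq_smul_of_odd hmm hmu ha,
      list_prod_mul_eq_smul_of_odd hmm hmv (n := b) (by omega), hm'eq]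
    have key : m * (u.map F).prod * (m * F i₀ * (m * (v.map F).prod))
        = (x₀ ^ 2 + r ^ 2) • (m' * ((u.map F).prod * (F i₀ * (v.map F).prod))) := by
      calc m * (u.map F).prod * (m * F i₀ * (m * (v.map F).prod))
          = m * ((u.map F).prod * m) * (F i₀ * m) * (v.map F).prod := by simp only [mul_assoc]
        _ = (m * m') * ((u.map F).prod * m) * F i₀ * (v.map F).prod := by
            conv_lhs => rw [hqm, hme]
            simp only [mul_assoc]
        _ = _ := by rw [hmm, hqm]; simp only [smul_mul_assoc, one_mul, mul_assoc]
    simp only [smul_mul_assoc, mul_smul_comm, smul_smul, ← mul_assoc] at key ⊢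
    rw [key, smul_smul]
    congr 1
    ring

end CliffordLists

section Sign

variable {A : Type*} [Ring A]

theorem list_ofFn_prod_swap_adjacent {n : ℕ} (f : Fin (n + 1) → A) (i : Fin n)
    (h : f i.castSucc * f i.succ = -(f i.succ * f i.castSucc)) :
    (List.ofFn (f ∘ Equiv.swap i.castSucc i.succ)).prod = -(List.ofFn f).prod := by
  induction n with
  | zero => exact i.elim0
  | succ n ih =>
    induction i using Fin.cases with
    | zero =>
      have h2 : ∀ j : Fin n, Equiv.swap (0 : Fin (n + 2)) 1 j.succ.succ = j.succ.succ := fun j =>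
        Equiv.swap_apply_of_ne_of_ne (by simp) (by simp [Fin.ext_iff])
      simp only [Fin.castSucc_zero, Fin.succ_zero_eq_one] at h
      simp [List.ofFn_succ, h2, ← mul_assoc, h]
    | succ j =>
      have h0 : Equiv.swap j.succ.castSucc j.succ.succ (0 : Fin (n + 2)) = 0 :=
        Equiv.swap_apply_of_ne_of_ne (by simp [Fin.ext_iff]) (by simp [Fin.ext_iff])
      have hs : ∀ a : Fin (n + 1), Equiv.swap j.succ.castSucc j.succ.succ a.succ
          = (Equiv.swap j.castSucc j.succ a).succ := fun a => by
        rw [← Fin.succ_castSucc]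
        exact ((Fin.succ_injective _).map_swap _ _ a).symm
      have := ih (fun a => f a.succ) j (by simpa only [Fin.succ_castSucc] using h)
      rw [List.ofFn_succ, List.ofFn_succ (f := f), List.prod_cons, List.prod_cons,
        ← mul_neg, ← this]
      simp only [Function.comp_def, h0, hs]

theorem list_ofFn_prod_perm {n : ℕ} {f : Fin n → A}
    (hf : ∀ i j, i ≠ j → f i * f j = -(f j * f i)) (σ : Equiv.Perm (Fin n)) :
    (List.ofFn (f ∘ σ)).prod = ((Equiv.Perm.sign σ : ℤ) : A) * (List.ofFn f).prod := by
  obtain _ | n := n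
  · simp [Subsingleton.elim σ 1]
  have hσ : σ ∈ Submonoid.closure
      (Set.range fun i : Fin n => Equiv.swap i.castSucc i.succ) := by
    rw [Equiv.Perm.mclosure_swap_castSucc_succ]; trivial
  induction hσ using Submonoid.closure_induction_right with
  | one => simp
  | mul_right σ _ τ hτ ih =>
    obtain ⟨i, rfl⟩ := hτ
    rw [Equiv.Perm.coe_mul, ← Function.comp_assoc, list_ofFn_prod_swap_adjacent, ih]
    · have : i.castSucc ≠ i.succ := i.castSucc_lt_succ.ne
      simp [Equiv.Perm.sign_swap this]
    · exact hf _ _ (by simpa using i.castSucc_lt_succ.ne)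

end Sign

section Rotation

variable {p : ℕ}

/-- The linear map `v ↦ ∑ᵢ vᵢ Eᵢ`. -/
noncomputable def cliffordMap {A : Type*} [Ring A] [Algebra ℝ A] (E : Fin p → A) :
    EuclideanSpace ℝ (Fin p) →ₗ[ℝ] A where
  toFun v := ∑ i, v i • E i
  map_add' v w := by simp [add_smul, Finset.sum_add_distrib]
  map_smul' a v := by simp [Finset.smul_sum, smul_smul]

theorem cliffordMap_apply {A : Type*} [Ring A] [Algebra ℝ A] (E : Fin p → A)
    (v : EuclideanSpace ℝ (Fin p)) : cliffordMap E v = ∑ i, v i • E i := rfl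

theorem cliffordMap_single {A : Type*} [Ring A] [Algebra ℝ A] (E : Fin p → A) (i : Fin p) :
    cliffordMap E (EuclideanSpace.single i 1) = E i := by
  simp [cliffordMap_apply]

theorem cliffordMap_mul_add_mul {A : Type*} [Ring A] [Algebra ℝ A] {E : Fin p → A}
    (hE : ∀ i j, E i * E j + E j * E i = if i = j then (-2 : ℝ) • (1 : A) else 0)
    (v w : EuclideanSpace ℝ (Fin p)) :
    cliffordMap E v * cliffordMap E w + cliffordMap E w * cliffordMap E v
      = (-2 * inner ℝ v w) • (1 : A) := by
  have h : ∀ i j, (v i • E i) * (w j • E j) + (w j • E j) * (v i • E i)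
      = if i = j then (-2 * (v i * w i)) • (1 : A) else 0 := fun i j => by
    have : (v i • E i) * (w j • E j) + (w j • E j) * (v i • E i)
        = (v i * w j) • (E i * E j + E j * E i) := by
      simp only [smul_mul_assoc, mul_smul_comm, smul_smul, smul_add, mul_comm]
    rw [this, hE]
    split_ifs with hij
    · subst hij; rw [smul_smul, mul_comm]
    · simp
  rw [cliffordMap_apply, cliffordMap_apply, Finset.sum_mul_sum, Finset.sum_mul_sum,
    Finset.sum_comm (f := fun i j => w i • E i * v j • E j), ← Finset.sum_add_distrib]
  simp only [← Finset.sum_add_distrib, h]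
  simp [PiLp.inner_apply, Finset.mul_sum, Finset.sum_smul, mul_comm]

/-- The multilinear map `(v₁, …, v_p) ↦ tr (m c(v₁) ⋯ m c(v_p))`, with `c = cliffordMap E`. -/
noncomputable def traceProdMap {N : ℕ} (E : Fin p → Matrix (Fin N) (Fin N) ℂ)
    (m : Matrix (Fin N) (Fin N) ℂ) :
    MultilinearMap ℝ (fun _ : Fin p => EuclideanSpace ℝ (Fin p)) ℂ :=
  (traceLinearMap (Fin N) ℝ ℂ).compMultilinearMap
    ((MultilinearMap.mkPiAlgebraFin ℝ p (Matrix (Fin N) (Fin N) ℂ)).compLinearMap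
      fun _ => LinearMap.mulLeft ℝ m ∘ₗ cliffordMap E)

theorem traceProdMap_apply {N : ℕ} (E : Fin p → Matrix (Fin N) (Fin N) ℂ)
    (m : Matrix (Fin N) (Fin N) ℂ) (v : Fin p → EuclideanSpace ℝ (Fin p)) :
    traceProdMap E m v = (List.ofFn fun a => m * cliffordMap E (v a)).prod.trace := by
  simp [traceProdMap]

theorem alternatization_traceProdMap_single {N : ℕ} (E : Fin p → Matrix (Fin N) (Fin N) ℂ)
    (m : Matrix (Fin N) (Fin N) ℂ) :
    MultilinearMap.alternatization (traceProdMap E m) (fun i => EuclideanSpace.single i 1)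
      = ∑ σ : Equiv.Perm (Fin p), ((Equiv.Perm.sign σ : ℤ) : ℂ) *
        (List.ofFn fun a : Fin p => m * E (σ a)).prod.trace := by
  rw [MultilinearMap.alternatization_apply]
  refine Finset.sum_congr rfl fun σ _ => ?_
  rw [MultilinearMap.domDomCongr_apply, traceProdMap_apply]
  simp only [cliffordMap_single, Units.smul_def, zsmul_eq_mul]

theorem trace_eq_zero_of_anticommute {N : ℕ} {X b : Matrix (Fin N) (Fin N) ℂ}
    (hb : b * b = -1) (h : X * b = -(b * X)) : X.trace = 0 := by
  have h1 : (b * X * b).trace = -X.trace := by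
    rw [trace_mul_comm, ← mul_assoc, hb, neg_one_mul, trace_neg]
  have h2 : (b * X * b).trace = X.trace := by
    rw [mul_assoc, h, mul_neg, ← mul_assoc, hb, neg_one_mul, neg_neg]
  exact self_eq_neg.1 (h2.symm.trans h1)

theorem trace_list_prod_mul {ι : Type*} {N n : ℕ} {F : ι → Matrix (Fin N) (Fin N) ℂ}
    (hF : ∀ i j, i ≠ j → F i * F j = -(F j * F i)) (hsq : ∀ i, F i * F i = -1)
    {i₀ j : ι} (hj : j ≠ i₀) (x₀ r : ℝ) {l : List ι} (hl : l.Nodup)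
    (hi : i₀ ∈ l) (hjl : j ∈ l) (hlen : l.length = 2 * n + 1) :
    (l.map fun i => (x₀ • (1 : Matrix (Fin N) (Fin N) ℂ) - r • F i₀) * F i).prod.trace
      = (x₀ * (x₀ ^ 2 + r ^ 2) ^ n) • (l.map F).prod.trace := by
  obtain ⟨s, hs⟩ := exists_list_prod_mul_eq hF hsq x₀ r hl hi hlen
  have h0 : (F i₀ * (l.map F).prod).trace = 0 := by
    refine trace_eq_zero_of_anticommute (hsq j) ?_
    rw [mul_assoc, ← commute_list_prod_of_anticommute hF hl hjl ⟨n, hlen⟩, ← mul_assoc,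
      hF i₀ j hj.symm, neg_mul, mul_assoc]
  rw [hs, sub_mul, smul_mul_assoc, smul_mul_assoc, one_mul, trace_smul, trace_sub, trace_smul,
    trace_smul, h0, smul_zero, sub_zero, smul_smul, mul_comm]

theorem exists_orthonormalBasis_smul_eq (i₀ : Fin p) (x : EuclideanSpace ℝ (Fin p)) :
    ∃ b : OrthonormalBasis (Fin p) ℝ (EuclideanSpace ℝ (Fin p)), ‖x‖ • b i₀ = x := by
  by_cases hx : x = 0
  · exact ⟨EuclideanSpace.basisFun _ _, by simp [hx]⟩
  · have hv : Orthonormal ℝ (({i₀} : Set (Fin p)).domRestrict fun _ => ‖x‖⁻¹ • x) := by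
      refine ⟨fun _ => ?_, fun i j hij => (hij (Subsingleton.elim i j)).elim⟩
      change ‖‖x‖⁻¹ • x‖ = 1
      simp [norm_smul, hx]
    obtain ⟨b, hb⟩ := hv.exists_orthonormalBasis_extension_of_card_eq (by simp)
    refine ⟨b, ?_⟩
    rw [hb i₀ rfl, smul_smul, mul_inv_cancel₀ (norm_ne_zero_iff.2 hx), one_smul]

theorem alternatization_traceProdMap_eq {N n : ℕ} (hn : 1 ≤ n) (hp : p = 2 * n + 1)
    {E : Fin p → Matrix (Fin N) (Fin N) ℂ}
    (hE : ∀ i j, E i * E j + E j * E i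
      = if i = j then (-2 : ℝ) • (1 : Matrix (Fin N) (Fin N) ℂ) else 0)
    (x₀ : ℝ) (x : EuclideanSpace ℝ (Fin p)) :
    MultilinearMap.alternatization (traceProdMap E (x₀ • 1 - cliffordMap E x))
      = (x₀ * (x₀ ^ 2 + ‖x‖ ^ 2) ^ n) • MultilinearMap.alternatization (traceProdMap E 1) := by
  obtain ⟨b, hb⟩ := exists_orthonormalBasis_smul_eq (⟨0, by omega⟩ : Fin p) x
  set i₀ : Fin p := ⟨0, by omega⟩ with hi₀
  have hanti : ∀ i j, i ≠ j → cliffordMap E (b i) * cliffordMap E (b j)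
      = -(cliffordMap E (b j) * cliffordMap E (b i)) := fun i j hij => by
    rw [← add_eq_zero_iff_eq_neg, cliffordMap_mul_add_mul hE, b.inner_eq_zero hij]
    simp
  have hsq : ∀ i, cliffordMap E (b i) * cliffordMap E (b i) = -1 := fun i => by
    have h := cliffordMap_mul_add_mul hE (b i) (b i)
    rw [b.inner_eq_one, ← two_smul ℝ, mul_one, neg_smul, ← smul_neg] at h
    exact smul_right_injective _ (two_ne_zero (α := ℝ)) h
  refine Module.Basis.ext_alternating b.toBasis fun v hv => ?_
  simp only [AlternatingMap.smul_apply, MultilinearMap.alternatization_apply, Finset.smul_sum,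
    MultilinearMap.domDomCongr_apply, traceProdMap_apply, OrthonormalBasis.coe_toBasis]
  refine Finset.sum_congr rfl fun σ _ => ?_
  rw [smul_comm]
  congr 1
  have hinj : Function.Injective fun a => v (σ a) := hv.comp σ.injective
  have hmem : ∀ i, i ∈ List.ofFn fun a => v (σ a) := fun i =>
    List.mem_ofFn.2 (Finite.surjective_of_injective hinj i)
  have key := trace_list_prod_mul (F := fun i => cliffordMap E (b i)) hanti hsq
    (i₀ := i₀) (j := ⟨1, by omega⟩) (by simp [hi₀]) x₀ ‖x‖ (List.nodup_ofFn.2 hinj)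
    (hmem _) (hmem _) (by simpa using hp)
  rw [List.map_ofFn, List.map_ofFn, ← map_smul, hb] at key
  simpa [Function.comp_def] using key

end Rotation

/-- let `p = 2k-1` (`k ≥ 2`), `E₁,…,E_p` skew-adjoint Clifford
matrices, `M = x₀·I - Σᵢ x'ᵢ Eᵢ`. Then
`Σ_{σ ∈ S_p} sgn σ · tr(M E_{σ(1)} ⋯ M E_{σ(p)})
  = p! x₀ (x₀² + |x'|²)^{(p-1)/2} tr(E₁⋯E_p)`. -/
theorem stmt_10 (k : ℕ) (hk : 2 ≤ k) (p : ℕ) (hp : p = 2 * k - 1)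
    (N : ℕ) (hN : 1 ≤ N) (E : Fin p → Matrix (Fin N) (Fin N) ℂ)
    (hskew : ∀ i, (E i)ᴴ = -(E i))
    (hcliff : ∀ i j, E i * E j + E j * E i
      = if i = j then (-2 : ℂ) • (1 : Matrix (Fin N) (Fin N) ℂ) else 0)
    (x₀ : ℝ) (x' : Fin p → ℝ)
    (M : Matrix (Fin N) (Fin N) ℂ)
    (hM : M = (x₀ : ℂ) • (1 : Matrix (Fin N) (Fin N) ℂ)
      - ∑ i, (x' i : ℂ) • E i) :
    ∑ σ : Equiv.Perm (Fin p), ((Equiv.Perm.sign σ : ℤ) : ℂ) *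
        (List.ofFn fun a : Fin p => M * E (σ a)).prod.trace
      = (Nat.factorial p : ℂ) * (x₀ : ℂ)
        * (((x₀ ^ 2 + ∑ i, x' i ^ 2 : ℝ) ^ (((p : ℝ) - 1) / 2) : ℝ) : ℂ)
        * (List.ofFn E).prod.trace := by
  have hp' : p = 2 * (k - 1) + 1 := by omega
  have hE : ∀ i j, E i * E j + E j * E i
      = if i = j then (-2 : ℝ) • (1 : Matrix (Fin N) (Fin N) ℂ) else 0 := fun i j => by
    rw [hcliff]
    congr 1
    ext a b
    simp
  have hanti : ∀ i j, i ≠ j → E i * E j = -(E j * E i) := fun i j hij => by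
    rw [← add_eq_zero_iff_eq_neg, hE, if_neg hij]
  have hM' : M = x₀ • 1 - cliffordMap E (WithLp.toLp 2 x') := by
    rw [hM, cliffordMap_apply]
    simp only [Complex.coe_smul]
  have hnorm : ‖WithLp.toLp 2 x'‖ ^ 2 = ∑ i, x' i ^ 2 := by
    simp [EuclideanSpace.norm_sq_eq]
  have hpow : (x₀ ^ 2 + ∑ i, x' i ^ 2 : ℝ) ^ (((p : ℝ) - 1) / 2)
      = (x₀ ^ 2 + ∑ i, x' i ^ 2) ^ (k - 1) := by
    have hexp : ((p : ℝ) - 1) / 2 = ((k - 1 : ℕ) : ℝ) := by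
      have : (p : ℝ) = 2 * ((k - 1 : ℕ) : ℝ) + 1 := by exact_mod_cast hp'
      rw [this]
      ring
    rw [hexp, Real.rpow_natCast]
  have hone : ∑ σ : Equiv.Perm (Fin p), ((Equiv.Perm.sign σ : ℤ) : ℂ) *
      (List.ofFn fun a : Fin p => 1 * E (σ a)).prod.trace
      = (Nat.factorial p : ℂ) * (List.ofFn E).prod.trace := by
    have h : ∀ σ : Equiv.Perm (Fin p), ((Equiv.Perm.sign σ : ℤ) : ℂ) *
        (List.ofFn fun a : Fin p => 1 * E (σ a)).prod.trace = (List.ofFn E).prod.trace := by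
      intro σ
      have hσ := list_ofFn_prod_perm hanti σ
      simp only [Function.comp_def] at hσ
      simp only [one_mul]
      rw [hσ]
      rcases Int.units_eq_one_or (Equiv.Perm.sign σ) with h | h <;> simp [h]
    rw [Finset.sum_congr rfl fun σ _ => h σ]
    simp [Fintype.card_perm]
  have key := congrArg (fun f => f fun i => EuclideanSpace.single i (1 : ℝ))
    (alternatization_traceProdMap_eq (by omega) hp' hE x₀ (WithLp.toLp 2 x'))
  simp only [AlternatingMap.smul_apply, alternatization_traceProdMap_single, hone, hnorm,
    ← hM'] at key
  rw [key, hpow, Complex.real_smul]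
  push_cast
  ring
end
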